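/- arXiv:0903.4412 — 6 statements merged into one kernel-verified Lean document; each statement's English description precedes it below -/
import Mathlib

section
/- Let Γ be a group acting by homeomorphisms on a topological space E such that the action is wandering: every point x ∈ E has an open neighborhood U with (g • U) ∩ U = ∅ for every g ∈ Γ with g ≠ 1. Suppose the quotient space E/Γ (the orbit space with the quotient topology) is paracompact and Hausdorff. Then there exists a continuous function h : E → ℝ with 0 ≤ h(x) ≤ 1 for all x, such that: (1) every x ∈ E has an open neighborhood W such that the set {g ∈ Γ : (g • W) ∩ supp(h) ≠ ∅} is finite, where supp(h) denotes the closure of {y : h(y) ≠ 0}; and (2) for every x ∈ E the set {g ∈ Γ : h(g • x) ≠ 0} is finite and Σ_{g ∈ Γ} h(g • x) = 1. -/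
open scoped Pointwise

section Wandering

variable {Γ E : Type*} [Group Γ] [MulAction Γ E] {U T : Set E}

theorem eq_of_smul_mem_of_smul_mem (hU : ∀ g : Γ, g ≠ 1 → (g • U) ∩ U = ∅) {x : E} {a b : Γ}
    (ha : a • x ∈ U) (hb : b • x ∈ U) : a = b := by
  by_contra hab
  have hne : b * a⁻¹ ≠ 1 := fun h => hab (mul_inv_eq_one.mp h).symm
  have hmem : b • x ∈ ((b * a⁻¹) • U) ∩ U :=
    ⟨⟨a • x, ha, by simp [mul_smul]⟩, hb⟩
  rw [hU _ hne] at hmem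
  exact hmem

theorem finsum_indicator_smul_of_wandering
    (hU : ∀ g : Γ, g ≠ 1 → (g • U) ∩ U = ∅) {f : E → ℝ}
    (hf : ∀ (g : Γ) x, f (g • x) = f x) (hfU : ∀ x, f x ≠ 0 → ∃ g : Γ, g • x ∈ U) (x : E) :
    ∑ᶠ g : Γ, U.indicator f (g • x) = f x := by
  by_cases hx : ∃ g : Γ, g • x ∈ U
  · obtain ⟨a, ha⟩ := hx
    rw [finsum_eq_single _ a, Set.indicator_of_mem ha, hf]
    exact fun b hb => Set.indicator_of_notMem
      (fun hbU => hb (eq_of_smul_mem_of_smul_mem hU hbU ha)) _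
  · have h0 : f x = 0 := by
      by_contra h
      exact hx (hfU x h)
    rw [h0]
    exact finsum_eq_zero_of_forall_eq_zero fun g =>
      Set.indicator_of_notMem (fun hg => hx ⟨g, hg⟩) _

variable [TopologicalSpace E] [ContinuousConstSMul Γ E]

theorem isClosed_inter_of_wandering (hUo : IsOpen U)
    (hU : ∀ g : Γ, g ≠ 1 → (g • U) ∩ U = ∅) (hT : IsClosed T)
    (hTU : ∀ x ∈ T, ∃ g : Γ, g • x ∈ U) : IsClosed (U ∩ T) := by
  have heq : U ∩ T = T ∩ (⋃ g : {g : Γ // g ≠ 1}, g.1 • U)ᶜ := by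
    ext x
    simp only [Set.mem_inter_iff, Set.mem_compl_iff, Set.mem_iUnion, not_exists]
    constructor
    · rintro ⟨hxU, hxT⟩
      refine ⟨hxT, fun g hg => ?_⟩
      have hmem : x ∈ (g.1 • U) ∩ U := ⟨hg, hxU⟩
      rw [hU _ g.2] at hmem
      exact hmem
    · rintro ⟨hxT, hx⟩
      refine ⟨?_, hxT⟩
      obtain ⟨g, hg⟩ := hTU x hxT
      by_cases h1 : g = 1
      · simpa [h1] using hg
      · exact absurd (Set.mem_smul_set_iff_inv_smul_mem.mpr (by simpa using hg))
          (hx ⟨g⁻¹, inv_ne_one.mpr h1⟩)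
  rw [heq]
  exact hT.inter (isOpen_iUnion fun g : {g : Γ // g ≠ 1} => hUo.smul g.1).isClosed_compl

theorem continuous_indicator_of_wandering (hUo : IsOpen U)
    (hU : ∀ g : Γ, g ≠ 1 → (g • U) ∩ U = ∅) {f : E → ℝ} (hf : Continuous f)
    (hfU : ∀ x, f x ≠ 0 → ∃ g : Γ, g • x ∈ U) : Continuous (U.indicator f) := by
  refine continuous_indicator (fun x hx => ?_) hf.continuousOn
  by_contra hne
  rw [hUo.frontier_eq] at hx
  obtain ⟨g, hg⟩ := hfU x hne
  have h1 : g⁻¹ ≠ 1 := by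
    intro h
    rw [inv_eq_one] at h
    exact hx.2 (by simpa [h] using hg)
  have hxg : x ∈ g⁻¹ • U := Set.mem_smul_set_iff_inv_smul_mem.mpr (by simpa using hg)
  have hmeet := mem_closure_iff.mp hx.1 _ (hUo.smul g⁻¹) hxg
  rw [hU _ h1] at hmeet
  exact Set.not_nonempty_empty hmeet

end Wandering

/-- Existence of a generalized Bruhat function for a wandering action with paracompact
Hausdorff orbit space. -/
theorem exists_bruhat_function
    {Γ E : Type*} [Group Γ] [TopologicalSpace E] [MulAction Γ E]
    (hcont : ∀ g : Γ, Continuous fun x : E => g • x)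
    (hwander : ∀ x : E, ∃ U : Set E, IsOpen U ∧ x ∈ U ∧
      ∀ g : Γ, g ≠ 1 → (g • U) ∩ U = ∅)
    [ParacompactSpace (Quotient (MulAction.orbitRel Γ E))]
    [T2Space (Quotient (MulAction.orbitRel Γ E))] :
    ∃ h : E → ℝ, Continuous h ∧ (∀ x, h x ∈ Set.Icc (0 : ℝ) 1) ∧
      (∀ x : E, ∃ W : Set E, IsOpen W ∧ x ∈ W ∧
        {g : Γ | ((g • W) ∩ tsupport h).Nonempty}.Finite) ∧
      (∀ x : E, {g : Γ | h (g • x) ≠ 0}.Finite ∧ ∑ᶠ g : Γ, h (g • x) = 1) := by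
  have : ContinuousConstSMul Γ E := ⟨hcont⟩
  choose U hUo hxU hU using hwander
  let p : E → Quotient (MulAction.orbitRel Γ E) := Quotient.mk _
  have hp : Continuous p := continuous_quotient_mk'
  have hpo : IsOpenMap p := isOpenMap_quotient_mk'_mul
  have hpg (g : Γ) (x : E) : p (g • x) = p x :=
    Quotient.sound (MulAction.orbitRel_apply.mpr ⟨g, rfl⟩)
  obtain ⟨ρ, hρ⟩ := PartitionOfUnity.exists_isSubordinate
    (isClosed_univ (X := Quotient (MulAction.orbitRel Γ E)))
    (fun i : E => p '' U i) (fun i => hpo _ (hUo i))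
    (fun q _ => by
      obtain ⟨x, rfl⟩ := Quotient.exists_rep q
      exact Set.mem_iUnion.mpr ⟨x, x, hxU x, rfl⟩)
  have hlift (i x : E) (hx : p x ∈ tsupport (ρ i)) : ∃ g : Γ, g • x ∈ U i := by
    obtain ⟨y, hy, hyx⟩ := hρ i hx
    obtain ⟨g, hg⟩ := MulAction.orbitRel_apply.mp (Quotient.exact hyx)
    exact ⟨g, by simpa [hg] using hy⟩
  have hlift' (i x : E) (hx : ρ i (p x) ≠ 0) : ∃ g : Γ, g • x ∈ U i :=
    hlift i x (subset_tsupport _ hx)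
  let k (i : E) : E → ℝ := (U i).indicator fun x => ρ i (p x)
  have hk0 (i x : E) : 0 ≤ k i x := Set.indicator_nonneg (fun _ _ => ρ.nonneg i _) x
  have hkle (i x : E) : k i x ≤ ρ i (p x) :=
    Set.indicator_le_self' (fun _ _ => ρ.nonneg i _) x
  have hkne (i x : E) (hx : k i x ≠ 0) : x ∈ U i ∧ ρ i (p x) ≠ 0 :=
    Set.indicator_apply_ne_zero.mp hx
  have hsum (x : E) : ∑ᶠ i, k i x = ∑ i ∈ ρ.finsupport (p x), k i x :=
    finsum_eq_sum_of_support_subset _ fun i hi =>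
      (ρ.mem_finsupport (p x)).mpr (hkne i x hi).2
  have hfin (x : E) : ∃ W : Set E, IsOpen W ∧ x ∈ W ∧
      {g : Γ | ((g • W) ∩ tsupport fun y => ∑ᶠ i, k i y).Nonempty}.Finite := by
    have hsupp : (tsupport fun y => ∑ᶠ i, k i y) ⊆ ⋃ i, U i ∩ p ⁻¹' tsupport (ρ i) := by
      refine closure_minimal (fun y hy => ?_) (LocallyFinite.isClosed_iUnion
        ((ρ.locallyFinite_tsupport.preimage_continuous hp).subset
          fun i => Set.inter_subset_right)
        fun i => isClosed_inter_of_wandering (hUo i) (hU i)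
          ((isClosed_tsupport _).preimage hp) (hlift i))
      obtain ⟨i, hi⟩ : ∃ i, k i y ≠ 0 := by
        by_contra! h
        exact hy (finsum_eq_zero_of_forall_eq_zero h)
      exact Set.mem_iUnion.mpr ⟨i, (hkne i y hi).1, subset_tsupport _ (hkne i y hi).2⟩
    have hloc : ∀ i ∈ ρ.fintsupport (p x), ∃ g : Γ, g • x ∈ U i := fun i hi =>
      hlift i x ((ρ.mem_fintsupport_iff (p x) i).mp hi)
    choose! a ha using hloc
    have hev : ∀ᶠ y in nhds x, ρ.fintsupport (p y) ⊆ ρ.fintsupport (p x) ∧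
        ∀ i ∈ ρ.fintsupport (p x), a i • y ∈ U i :=
      (hp.continuousAt.eventually (ρ.eventually_fintsupport_subset (p x))).and
        ((Filter.eventually_all_finset _).mpr fun i hi =>
          (hcont (a i)).continuousAt.eventually ((hUo i).mem_nhds (ha i hi)))
    obtain ⟨W, hW, hWo, hxW⟩ := eventually_nhds_iff.mp hev
    refine ⟨W, hWo, hxW, ((ρ.fintsupport (p x)).finite_toSet.image a).subset ?_⟩
    rintro g ⟨_, ⟨w, hw, rfl⟩, hgw⟩
    obtain ⟨i, hiU, hi⟩ := Set.mem_iUnion.mp (hsupp hgw)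
    have hiF : i ∈ ρ.fintsupport (p x) := (hW w hw).1 <|
      (ρ.mem_fintsupport_iff (p w) i).mpr (by simpa [hpg] using hi)
    exact ⟨i, hiF, eq_of_smul_mem_of_smul_mem (hU i) ((hW w hw).2 i hiF) hiU⟩
  refine ⟨fun y => ∑ᶠ i, k i y, ?_, fun x => ⟨finsum_nonneg fun i => hk0 i x, ?_⟩, hfin,
    fun x => ⟨?_, ?_⟩⟩
  · exact continuous_finsum
      (fun i => continuous_indicator_of_wandering (hUo i) (hU i)
        ((ρ i).continuous.comp hp) (hlift' i))
      ((ρ.locallyFinite.preimage_continuous hp).subset fun i y hy => (hkne i y hy).2)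
  · dsimp only
    rw [hsum, ← ρ.sum_finsupport (Set.mem_univ (p x))]
    exact Finset.sum_le_sum fun i _ => hkle i x
  · obtain ⟨W, -, hxW, hW⟩ := hfin x
    exact hW.subset fun g hg => ⟨g • x, Set.smul_mem_smul_set hxW, subset_tsupport _ hg⟩
  · simp only [hsum, hpg]
    rw [finsum_sum_comm, ← ρ.sum_finsupport (Set.mem_univ (p x))]
    · exact Finset.sum_congr rfl fun i _ => finsum_indicator_smul_of_wandering (hU i)
        (fun g y => by rw [hpg]) (hlift' i) x
    · exact fun i _ => Set.Subsingleton.finite fun a ha b hb =>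
        eq_of_smul_mem_of_smul_mem (hU i) (hkne i _ ha).1 (hkne i _ hb).1
end

section
/- Let p : E → B be a covering map between topological spaces. Then for every n ∈ ℕ the induced map p_* : C(Δⁿ, E) → C(Δⁿ, B), s ↦ p ∘ s, where both mapping spaces carry the compact-open topology and Δⁿ is the standard n-simplex, is itself a covering map. -/
/-- The pullback of a covering map along a continuous map is a covering map. -/
theorem IsCoveringMap.pullback_fst {X Y E : Type*} [TopologicalSpace X] [TopologicalSpace Y]
    [TopologicalSpace E] {p : E → X} (hp : IsCoveringMap p) {g : Y → X} (hg : Continuous g) :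
    IsCoveringMap (fun z : {z : Y × E // g z.1 = p z.2} => z.1.1) := by
  intro y
  obtain ⟨hI, U, hyU, hU, -, H, hH⟩ := hp (g y)
  have hsymm (u : U × p ⁻¹' {g y}) : p (H.symm u) = u.1 := by rw [← hH]; simp
  have hmem (z : (fun z : {z : Y × E // g z.1 = p z.2} => z.1.1) ⁻¹' (g ⁻¹' U)) :
      z.1.1.2 ∈ p ⁻¹' U := Set.mem_preimage.2 (z.1.2 ▸ z.2)
  refine IsEvenlyCovered.to_isEvenlyCovered_preimage (I := p ⁻¹' {g y})
    ⟨hI, g ⁻¹' U, hyU, hU.preimage hg, (hU.preimage hg).preimage (by fun_prop), ?_⟩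
  refine ⟨
    { toFun z := (⟨z.1.1.1, z.2⟩, (H ⟨z.1.1.2, hmem z⟩).2)
      invFun w := ⟨⟨(w.1, H.symm (⟨g w.1, w.1.2⟩, w.2)), by simp [hsymm]⟩, w.1.2⟩
      left_inv z := ?_
      right_inv w := by simp
      continuous_toFun := by fun_prop
      continuous_invFun := by fun_prop }, fun _ => rfl⟩
  have hz : H ⟨z.1.1.2, hmem z⟩ = (⟨g z.1.1.1, z.2⟩, (H ⟨z.1.1.2, hmem z⟩).2) :=
    Prod.ext (Subtype.ext ((hH _).trans z.1.2.symm)) rfl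
  ext
  · rfl
  · simp [← hz]

/-- If `K` is strongly contractible to a point `v`, then for a covering map `p : E → B` a map
`K → E` amounts to a map `σ : K → B` together with a lift of `σ v` to `E`. -/
noncomputable def IsCoveringMap.homeomorphPullbackOfContraction {E B K : Type*}
    [TopologicalSpace E] [TopologicalSpace B] [TopologicalSpace K] [LocallyCompactSpace K]
    {p : E → B} (hp : IsCoveringMap p) (F : C(unitInterval × K, K)) (v : K)
    (hF₀ : ∀ x, F (0, x) = v) (hF₁ : ∀ x, F (1, x) = x) (hFv : ∀ t, F (t, v) = v) :
    C(K, E) ≃ₜ {z : C(K, B) × E // z.1 v = p z.2} :=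
  let H : C(unitInterval × ({z : C(K, B) × E // z.1 v = p z.2} × K), B) :=
    ⟨fun w => w.2.1.1.1 (F (w.1, w.2.2)),
      (by fun_prop : Continuous fun w : unitInterval × ({z : C(K, B) × E // z.1 v = p z.2} × K) =>
        w.2.1.1.1).eval (by fun_prop)⟩
  let f : C({z : C(K, B) × E // z.1 v = p z.2} × K, E) := ⟨fun w => w.1.1.2, by fun_prop⟩
  have H_0 (a) : H (0, a) = p (f a) := by simpa [H, f, hF₀] using a.1.2
  let L := hp.liftHomotopy H f H_0
  { toFun s := ⟨((ContinuousMap.mk p hp.continuous).comp s, s v), rfl⟩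
    invFun z := (ContinuousMap.mk (fun w => L (1, w)) (by fun_prop)).curry z
    left_inv s := by
      ext x
      refine .trans ?_ (congrArg s (hF₁ x))
      let z : {z : C(K, B) × E // z.1 v = p z.2} :=
        ⟨((ContinuousMap.mk p hp.continuous).comp s, s v), rfl⟩
      have h := (hp.eq_liftPath_iff'
        (γ := H.comp ⟨fun t : unitInterval => (t, (z, x)), by fun_prop⟩)
        (e := s v) (γ_0 := H_0 (z, x))
        (Γ := s.comp ⟨fun t : unitInterval => F (t, x), by fun_prop⟩)).mpr
        ⟨rfl, by simp [hF₀]⟩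
      exact (DFunLike.congr_fun h 1).symm
    right_inv z := by
      refine Subtype.ext (Prod.ext (ContinuousMap.ext fun x => ?_) ?_)
      · exact (congr_fun (hp.liftHomotopy_lifts H f H_0) (1, (z, x))).trans
          (congrArg z.1.1 (hF₁ x))
      · have h := (hp.eq_liftPath_iff'
          (γ := H.comp ⟨fun t : unitInterval => (t, (z, v)), by fun_prop⟩)
          (e := z.1.2) (γ_0 := H_0 (z, v)) (Γ := .const unitInterval z.1.2)).mpr
          ⟨by ext t; simpa [H, hFv] using z.2.symm, rfl⟩
        exact (DFunLike.congr_fun h 1).symm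
    continuous_toFun := by fun_prop
    continuous_invFun := ContinuousMap.continuous _ }

/-- A covering map `p : E → B` induces a covering map `C(K, E) → C(K, B)` whenever `K` is strongly
contractible to a point. -/
theorem IsCoveringMap.comp_continuousMap_of_contraction {E B K : Type*}
    [TopologicalSpace E] [TopologicalSpace B] [TopologicalSpace K] [LocallyCompactSpace K]
    {p : E → B} (hp : IsCoveringMap p) (F : C(unitInterval × K, K)) (v : K)
    (hF₀ : ∀ x, F (0, x) = v) (hF₁ : ∀ x, F (1, x) = x) (hFv : ∀ t, F (t, v) = v) :
    IsCoveringMap (fun s : C(K, E) => (ContinuousMap.mk p hp.continuous).comp s) :=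
  (hp.pullback_fst (g := fun σ : C(K, B) => σ v) (by fun_prop)).comp_homeomorph
    (hp.homeomorphPullbackOfContraction F v hF₀ hF₁ hFv)

/-- The straight-line contraction of a convex set onto one of its points. -/
def Convex.contraction {V : Type*} [AddCommGroup V] [Module ℝ V] [TopologicalSpace V]
    [ContinuousAdd V] [ContinuousSMul ℝ V] {s : Set V} (hs : Convex ℝ s) (v : s) :
    C(unitInterval × s, s) where
  toFun w := ⟨(1 - w.1 : ℝ) • (v : V) + (w.1 : ℝ) • (w.2 : V),
    hs v.2 w.2.2 (sub_nonneg.2 w.1.2.2) w.1.2.1 (by ring)⟩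

/-- If `p : E → B` is a covering map, then the induced map `C(Δⁿ, E) → C(Δⁿ, B)`,
`s ↦ p ∘ s`, on spaces of singular simplices (with the compact-open topology) is again a
covering map. -/
theorem isCoveringMap_compContinuousMap_simplex
    {E B : Type*} [TopologicalSpace E] [TopologicalSpace B]
    (p : E → B) (hp : IsCoveringMap p) (n : ℕ) :
    IsCoveringMap (fun s : C(stdSimplex ℝ (Fin (n + 1)), E) =>
      (ContinuousMap.mk p hp.continuous).comp s) := by
  refine hp.comp_continuousMap_of_contraction
    ((convex_stdSimplex ℝ (Fin (n + 1))).contraction ⟨_, single_mem_stdSimplex ℝ 0⟩)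
    ⟨_, single_mem_stdSimplex ℝ 0⟩ (fun x => ?_) (fun x => ?_) (fun t => ?_)
  · exact Subtype.ext (by simp [Convex.contraction])
  · exact Subtype.ext (by simp [Convex.contraction])
  · exact Subtype.ext (by simp [Convex.contraction, ← add_smul])
end

section
/- Let X be a metrizable topological space, n ∈ ℕ, and let (Z_j)_{j ∈ J} be a locally finite family of closed subsets of X whose union is X. For each j ∈ J let f_j be a continuous real-valued function on the subspace {s ∈ C(Δⁿ, X) : s(Δⁿ) ⊆ Z_j} of C(Δⁿ, X) (compact-open topology), and assume compatibility: for all j, j' ∈ J and all s ∈ C(Δⁿ, X) with s(Δⁿ) ⊆ Z_j ∩ Z_{j'}, one has f_j(s) = f_{j'}(s). Then there exists a continuous function f : C(Δⁿ, X) → ℝ such that f(s) = f_j(s) whenever j ∈ J and s(Δⁿ) ⊆ Z_j. -/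
/-- If `(Z_j)` is a locally finite closed cover of a metrizable space `X`, then compatible
continuous real functions on the subspaces `{s ∈ C(Δⁿ, X) : s(Δⁿ) ⊆ Z_j}` glue to a global
continuous function on `C(Δⁿ, X)`. -/
theorem exists_continuous_cochain_extension
    {X : Type*} [TopologicalSpace X] [TopologicalSpace.MetrizableSpace X]
    (n : ℕ) {J : Type*} (Z : J → Set X)
    (hlf : LocallyFinite Z) (hcl : ∀ j, IsClosed (Z j)) (hcover : ⋃ j, Z j = Set.univ)
    (f : ∀ j : J, {s : C(stdSimplex ℝ (Fin (n + 1)), X) // ∀ q, s q ∈ Z j} → ℝ)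
    (hf : ∀ j, Continuous (f j))
    (hcompat : ∀ (j j' : J) (s : C(stdSimplex ℝ (Fin (n + 1)), X))
      (h : ∀ q, s q ∈ Z j) (h' : ∀ q, s q ∈ Z j'), f j ⟨s, h⟩ = f j' ⟨s, h'⟩) :
    ∃ F : C(stdSimplex ℝ (Fin (n + 1)), X) → ℝ, Continuous F ∧
      ∀ (j : J) (s : C(stdSimplex ℝ (Fin (n + 1)), X)) (h : ∀ q, s q ∈ Z j),
        F s = f j ⟨s, h⟩ := by
  classical
  let K := stdSimplex ℝ (Fin (n + 1))
  let _ : MetricSpace X := TopologicalSpace.metrizableSpaceMetric X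
  let A : J → Set C(K, X) := fun j => {s | ∀ q, s q ∈ Z j}
  obtain ⟨q₀⟩ : Nonempty K := inferInstance
  have hAlf : LocallyFinite A :=
    (hlf.preimage_continuous (continuous_eval_const q₀)).subset fun j s hs => hs q₀
  have hAcl : ∀ j, IsClosed (A j) := fun j => by
    simp only [A, Set.ofPred_forall]
    exact isClosed_iInter fun q => (hcl j).preimage (continuous_eval_const q)
  let g : C(K, X) → ℝ := fun s =>
    if h : ∃ j, s ∈ A j then f h.choose ⟨s, h.choose_spec⟩ else 0
  have hg : ∀ j s (h : s ∈ A j), g s = f j ⟨s, h⟩ := fun j s h => by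
    have hex : ∃ j, s ∈ A j := ⟨j, h⟩
    simp only [g, dif_pos hex]
    exact hcompat _ _ s hex.choose_spec h
  have hgA : ∀ j, ContinuousOn g (A j) := fun j => by
    rw [continuousOn_iff_continuous_domRestrict]
    exact (hf j).congr fun s => (hg j s s.2).symm
  have hgT : ContinuousOn g (⋃ j, A j) := hAlf.continuousOn_iUnion hAcl hgA
  obtain ⟨F, hF⟩ := ContinuousMap.exists_restrict_eq (hAlf.isClosed_iUnion hAcl)
    (⟨_, hgT.domRestrict⟩ : C(⋃ j, A j, ℝ))
  refine ⟨F, F.continuous, fun j s h => ?_⟩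
  rw [← hg j s h]
  exact DFunLike.congr_fun hF ⟨s, Set.mem_iUnion.2 ⟨j, h⟩⟩
end

section
/- Let X₁ = (({0} ∪ {1/n : n ∈ ℕ, n ≥ 1}) × [0,1]) ∪ ([0,1] × {0,1}) ⊆ ℝ², with the subspace topology. Define continuous paths in X₁: α₀ : [0,1] → X₁, α₀(t) = (0, 1−t); and for each integer i ≥ 1, αᵢ : [0,1] → X₁ given by αᵢ(t) = (3t/i, 0) for t ∈ [0, 1/3], αᵢ(t) = (1/i, 3t−1) for t ∈ [1/3, 2/3], and αᵢ(t) = ((3−3t)/i, 1) for t ∈ [2/3, 1]. Then there is no continuous function ψ : C([0,1], X₁) → ℝ (where C([0,1], X₁) carries the compact-open topology) such that ψ(α₀) + ψ(αᵢ) = (−1)ⁱ for every integer i ≥ 1. (Consequently the map i¹ : H¹_c(X₁) → H¹(X₁) from continuous to singular cohomology is not surjective.) -/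
/-- The modified Hawaiian earring: `(({0} ∪ {1/n : n ≥ 1}) × [0,1]) ∪ ([0,1] × {0,1}) ⊆ ℝ²`. -/
def hawaiianComb : Set (ℝ × ℝ) :=
  (({0} ∪ {x : ℝ | ∃ n : ℕ, 1 ≤ n ∧ x = 1 / n}) ×ˢ Set.Icc (0 : ℝ) 1) ∪
    (Set.Icc (0 : ℝ) 1 ×ˢ ({0, 1} : Set ℝ))

/-- The uniform limit of the loops around the teeth of the comb: the path climbing the segment
`{0} × [0,1]`
during the middle third of the unit interval. -/
noncomputable def hawaiianCombLimitPath : C(unitInterval, hawaiianComb) where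
  toFun t := ⟨(0, max 0 (min 1 (3 * (t : ℝ) - 1))),
    Or.inl ⟨Or.inl rfl, le_max_left _ _, max_le zero_le_one (min_le_left _ _)⟩⟩
  continuous_toFun := by fun_prop

lemma tendsto_hawaiianCombLimitPath (α : ℕ → C(unitInterval, hawaiianComb))
    (hα : ∀ i : ℕ, 1 ≤ i → ∀ t : unitInterval,
      ((α i) t : ℝ × ℝ) =
        if (t : ℝ) ≤ 1 / 3 then (3 * (t : ℝ) / i, 0)
        else if (t : ℝ) ≤ 2 / 3 then (1 / i, 3 * (t : ℝ) - 1)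
        else ((3 - 3 * (t : ℝ)) / i, 1)) :
    Filter.Tendsto α Filter.atTop (nhds hawaiianCombLimitPath) := by
  rw [tendsto_iff_dist_tendsto_zero]
  refine squeeze_zero' (Filter.Eventually.of_forall fun _ => dist_nonneg) ?_
    tendsto_one_div_atTop_nhds_zero_nat
  filter_upwards [Filter.eventually_ge_atTop 1] with i hi
  have hi0 : (0 : ℝ) < i := by exact_mod_cast hi
  rw [ContinuousMap.dist_le (by positivity)]
  intro t
  have ht0 := t.2.1
  have ht1 := t.2.2
  rw [Subtype.dist_eq, hα i hi t]
  change dist _ ((0 : ℝ), max 0 (min 1 (3 * (t : ℝ) - 1))) ≤ _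
  have key : ∀ a : ℝ, 0 ≤ a → a ≤ 1 → |a / i| ≤ 1 / i := fun a h0 h1 => by
    rw [abs_of_nonneg (by positivity)]
    gcongr
  have hpos : (0 : ℝ) ≤ 1 / i := by positivity
  split_ifs with h1 h2
  · rw [max_eq_left (min_le_of_right_le (by linarith)), Prod.dist_eq, dist_self,
      Real.dist_eq, sub_zero]
    exact max_le (key _ (by linarith) (by linarith)) hpos
  · rw [min_eq_right (by linarith), max_eq_right (by linarith), Prod.dist_eq, dist_self,
      Real.dist_eq, sub_zero]
    exact max_le (key _ zero_le_one le_rfl) hpos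
  · rw [min_eq_left (by linarith), max_eq_right zero_le_one, Prod.dist_eq, dist_self,
      Real.dist_eq, sub_zero]
    exact max_le (key _ (by linarith) (by linarith)) hpos

/-- There is no continuous function `ψ` on `C([0,1], X₁)` (compact-open topology) with
`ψ(α₀) + ψ(αᵢ) = (−1)ⁱ` for all `i ≥ 1`, where `α₀(t) = (0, 1−t)` and `αᵢ` traverses the
polygonal loop through `(0,0)`, `(1/i,0)`, `(1/i,1)`, `(0,1)`. Consequently
`i¹ : H¹_c(X₁) → H¹(X₁)` is not surjective. -/
theorem no_continuous_cochain_on_hawaiianComb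
    (α : ℕ → C(unitInterval, hawaiianComb))
    (h0 : ∀ t : unitInterval, ((α 0) t : ℝ × ℝ) = (0, 1 - (t : ℝ)))
    (hα : ∀ i : ℕ, 1 ≤ i → ∀ t : unitInterval,
      ((α i) t : ℝ × ℝ) =
        if (t : ℝ) ≤ 1 / 3 then (3 * (t : ℝ) / i, 0)
        else if (t : ℝ) ≤ 2 / 3 then (1 / i, 3 * (t : ℝ) - 1)
        else ((3 - 3 * (t : ℝ)) / i, 1)) :
    ¬ ∃ ψ : C(unitInterval, hawaiianComb) → ℝ, Continuous ψ ∧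
      ∀ i : ℕ, 1 ≤ i → ψ (α 0) + ψ (α i) = (-1 : ℝ) ^ i := by
  rintro ⟨ψ, hψ, h⟩
  have hlim : Filter.Tendsto (fun i => ψ (α 0) + ψ (α i)) Filter.atTop
      (nhds (ψ (α 0) + ψ hawaiianCombLimitPath)) :=
    ((hψ.tendsto _).comp (tendsto_hawaiianCombLimitPath α hα)).const_add _
  have hsum := (hlim.comp (Filter.tendsto_add_atTop_nat 1)).add hlim
  have hzero : Filter.Tendsto (fun i => ψ (α 0) + ψ (α (i + 1)) + (ψ (α 0) + ψ (α i)))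
      Filter.atTop (nhds 0) := by
    refine tendsto_const_nhds.congr' ?_
    filter_upwards [Filter.eventually_ge_atTop 1] with i hi
    rw [h i hi, h (i + 1) (by omega)]
    ring
  have hL : ψ (α 0) + ψ hawaiianCombLimitPath = 0 := by
    linarith [tendsto_nhds_unique hsum hzero]
  rw [hL] at hlim
  have habs : Filter.Tendsto (fun i => |ψ (α 0) + ψ (α i)|) Filter.atTop (nhds 1) := by
    refine tendsto_const_nhds.congr' ?_
    filter_upwards [Filter.eventually_ge_atTop 1] with i hi
    rw [h i hi, abs_neg_one_pow]
  have := tendsto_nhds_unique habs hlim.abs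
  norm_num at this
end

section
/- Let X₂ = (({1/n : n ∈ ℕ, n ≥ 1}) × [0,1]) ∪ ((0,1] × {−1,1}) ∪ ({0} × [−1,0]) ∪ ({1} × [−1,1]) ⊆ ℝ², with the subspace topology, and define f : X₂ → ℝ by f(x,y) = 0 if x = 0 or x = 1 or y = −1, and f(x,y) = 1 − y otherwise. Then: (a) the function Φ : C([0,1], X₂) → ℝ defined by Φ(s) = f(s(1)) − f(s(0)) is continuous, where C([0,1], X₂) carries the compact-open topology; and (b) there is no continuous function g : X₂ → ℝ such that f(s(1)) − f(s(0)) = g(s(1)) − g(s(0)) for every s ∈ C([0,1], X₂). (Consequently the map i¹ : H¹_c(X₂) → H¹(X₂) from continuous to singular cohomology is not injective.) -/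
/-- The modified comb space
`X₂ = ({1/n : n ≥ 1} × [0,1]) ∪ ((0,1] × {−1,1}) ∪ ({0} × [−1,0]) ∪ ({1} × [−1,1]) ⊆ ℝ²`. -/
def combSpace : Set (ℝ × ℝ) :=
  ({x : ℝ | ∃ n : ℕ, 1 ≤ n ∧ x = 1 / n} ×ˢ Set.Icc (0 : ℝ) 1) ∪
    (Set.Ioc (0 : ℝ) 1 ×ˢ ({-1, 1} : Set ℝ)) ∪
    (({0} : Set ℝ) ×ˢ Set.Icc (-1 : ℝ) 0) ∪
    (({1} : Set ℝ) ×ˢ Set.Icc (-1 : ℝ) 1)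

/-- The discontinuous 0-cochain `f(x,y) = 0` if `x = 0`, `x = 1` or `y = −1`, and
`f(x,y) = 1 − y` otherwise. -/
noncomputable def combCochain : combSpace → ℝ := fun p =>
  if (p : ℝ × ℝ).1 = 0 ∨ (p : ℝ × ℝ).1 = 1 ∨ (p : ℝ × ℝ).2 = -1 then 0
  else 1 - (p : ℝ × ℝ).2

open Set Filter Topology

lemma mem_combSpace {p : ℝ × ℝ} : p ∈ combSpace ↔
    (((∃ n : ℕ, 1 ≤ n ∧ p.1 = 1 / n) ∧ 0 ≤ p.2 ∧ p.2 ≤ 1 ∨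
      (0 < p.1 ∧ p.1 ≤ 1) ∧ (p.2 = -1 ∨ p.2 = 1)) ∨
      p.1 = 0 ∧ -1 ≤ p.2 ∧ p.2 ≤ 0) ∨ p.1 = 1 ∧ -1 ≤ p.2 ∧ p.2 ≤ 1 := by
  simp [combSpace]

lemma continuous_combSpace_fst : Continuous fun p : combSpace => (p : ℝ × ℝ).1 := by fun_prop

lemma continuous_combSpace_snd : Continuous fun p : combSpace => (p : ℝ × ℝ).2 := by fun_prop

lemma one_div_nat_eq_one_or_le_half {n : ℕ} (hn : 1 ≤ n) :
    (1 : ℝ) / n = 1 ∨ (1 : ℝ) / n ≤ 1 / 2 := by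
  obtain rfl | h := hn.eq_or_lt
  · simp
  · right
    exact one_div_le_one_div_of_le (by norm_num) (by exact_mod_cast h)

lemma combCochain_of_snd_neg {p : combSpace} (h : (p : ℝ × ℝ).2 < 0) : combCochain p = 0 := by
  have hp := mem_combSpace.1 p.2
  rw [combCochain, if_pos]
  grind

lemma combCochain_of_half_lt_fst {p : combSpace} (h : 1 / 2 < (p : ℝ × ℝ).1) :
    combCochain p = 0 := by
  rw [combCochain]
  split_ifs with hf
  · rfl
  · obtain ((⟨⟨n, hn, hx⟩, -⟩ | h') | h') | h' := mem_combSpace.1 p.2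
    · have := one_div_nat_eq_one_or_le_half hn
      grind
    all_goals grind

lemma combCochain_of_mem_Ioo {p : combSpace} (h0 : 0 < (p : ℝ × ℝ).1) (h1 : (p : ℝ × ℝ).1 < 1)
    (hy : -1 < (p : ℝ × ℝ).2) : combCochain p = 1 - (p : ℝ × ℝ).2 := by
  rw [combCochain, if_neg]
  grind

/-- The cochain is continuous away from the origin. -/
lemma continuousAt_combCochain {p : combSpace} (hp : (p : ℝ × ℝ) ≠ 0) :
    ContinuousAt combCochain p := by
  have hx := continuous_combSpace_fst
  have hy := continuous_combSpace_snd
  rcases lt_or_ge (p : ℝ × ℝ).2 0 with hy0 | hy0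
  · refine (continuousAt_const (y := (0 : ℝ))).congr ?_
    filter_upwards [(isOpen_Iio.preimage hy).mem_nhds hy0] with q hq
    exact (combCochain_of_snd_neg hq).symm
  rcases lt_or_ge (1 / 2) (p : ℝ × ℝ).1 with hx1 | hx1
  · refine (continuousAt_const (y := (0 : ℝ))).congr ?_
    filter_upwards [(isOpen_Ioi.preimage hx).mem_nhds hx1] with q hq
    exact (combCochain_of_half_lt_fst hq).symm
  have hx0 : 0 < (p : ℝ × ℝ).1 := by
    obtain ((⟨⟨n, hn, h⟩, -⟩ | h) | h) | h := mem_combSpace.1 p.2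
    · rw [h]
      positivity
    · exact h.1.1
    · exact absurd (Prod.ext h.1 (le_antisymm h.2.2 hy0)) hp
    · rw [h.1]
      exact one_pos
  have hcont : Continuous fun q : combSpace => 1 - (q : ℝ × ℝ).2 := continuous_const.sub hy
  refine hcont.continuousAt.congr ?_
  filter_upwards [(isOpen_Ioo.preimage hx).mem_nhds ⟨hx0, hx1.trans_lt one_half_lt_one⟩,
    (isOpen_Ioi.preimage hy).mem_nhds (show (-1 : ℝ) < (p : ℝ × ℝ).2 by linarith)] with q hq hq'
  exact (combCochain_of_mem_Ioo hq.1 hq.2 hq').symm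

/-- The open neighbourhood of the origin in the comb space which is a disjoint union of vertical
segments. -/
def combNhd : Set combSpace :=
  {p | (p : ℝ × ℝ).1 < 1 ∧ -1 < (p : ℝ × ℝ).2 ∧ (p : ℝ × ℝ).2 < 1}

lemma isOpen_combNhd : IsOpen combNhd := by
  have hx := continuous_combSpace_fst
  have hy := continuous_combSpace_snd
  exact (isOpen_lt hx continuous_const).inter
    ((isOpen_lt continuous_const hy).inter (isOpen_lt hy continuous_const))

lemma fst_mem_of_mem_combNhd {p : combSpace} (hp : p ∈ combNhd) :
    (p : ℝ × ℝ).1 ∈ range fun n : ℕ => (1 : ℝ) / n := by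
  obtain ⟨h1, h2, h3⟩ := hp
  obtain ((⟨⟨n, hn, h⟩, -⟩ | h) | h) | h := mem_combSpace.1 p.2
  · exact ⟨n, h.symm⟩
  · grind
  · exact ⟨0, by simp [h.1]⟩
  · grind

/-- Connected subsets of `combNhd` lie on a vertical line. -/
lemma fst_eq_of_isPreconnected {S : Set combSpace} (hS : IsPreconnected S) (hSU : S ⊆ combNhd)
    {p q : combSpace} (hp : p ∈ S) (hq : q ∈ S) : (p : ℝ × ℝ).1 = (q : ℝ × ℝ).1 :=
  (countable_range fun n : ℕ => (1 : ℝ) / n).isTotallyDisconnected _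
    (image_subset_iff.2 fun _ h => fst_mem_of_mem_combNhd (hSU h))
    (hS.image _ continuous_combSpace_fst.continuousOn)
    (mem_image_of_mem _ hp) (mem_image_of_mem _ hq)

lemma combCochain_of_mem_combNhd {p : combSpace} (hp : p ∈ combNhd) :
    combCochain p = (if (p : ℝ × ℝ).1 = 0 then 0 else 1) - max (p : ℝ × ℝ).2 0 := by
  obtain ⟨h1, h2, h3⟩ := hp
  rw [combCochain]
  obtain ((⟨⟨n, hn, h⟩, hy⟩ | h) | h) | h := mem_combSpace.1 p.2
  · have : (0 : ℝ) < 1 / n := by positivity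
    grind
  all_goals grind

lemma eventually_continuousAt_sub (s : C(unitInterval, combSpace)) (t : unitInterval) :
    ∀ᶠ u in 𝓝 t, ContinuousAt
      (fun s' : C(unitInterval, combSpace) => combCochain (s' u) - combCochain (s' t)) s := by
  have heval (v : unitInterval) (hv : ((s v : combSpace) : ℝ × ℝ) ≠ 0) :
      ContinuousAt (fun s' : C(unitInterval, combSpace) => combCochain (s' v)) s :=
    (continuousAt_combCochain hv).comp (f := fun s' : C(unitInterval, combSpace) => s' v)
      (continuous_eval_const v).continuousAt
  by_cases ht : ((s t : combSpace) : ℝ × ℝ) = 0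
  · have hst : s t ∈ combNhd := by simp [combNhd, ht]
    obtain ⟨a, b, htab, hab, hsub⟩ := exists_Icc_mem_subset_of_mem_nhds
      (s.continuous.continuousAt.preimage_mem_nhds (isOpen_combNhd.mem_nhds hst))
    filter_upwards [hab] with u hu
    have hcont : Continuous fun s' : C(unitInterval, combSpace) =>
        max (s' t : ℝ × ℝ).2 0 - max (s' u : ℝ × ℝ).2 0 := by
      have h (v : unitInterval) :
          Continuous fun s' : C(unitInterval, combSpace) => (s' v : ℝ × ℝ).2 :=
        continuous_combSpace_snd.comp (continuous_eval_const v)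
      exact ((h t).max continuous_const).sub ((h u).max continuous_const)
    refine hcont.continuousAt.congr ?_
    filter_upwards [ContinuousMap.eventually_mapsTo isCompact_Icc isOpen_combNhd hsub] with s' hs'
    have hfst := fst_eq_of_isPreconnected (isPreconnected_Icc.image s' s'.continuous.continuousOn)
      hs'.image_subset (mem_image_of_mem _ hu) (mem_image_of_mem _ htab)
    rw [combCochain_of_mem_combNhd (hs' hu), combCochain_of_mem_combNhd (hs' htab), hfst]
    ring
  · have hopen : IsOpen {u | ((s u : combSpace) : ℝ × ℝ) ≠ 0} :=
      isOpen_ne_fun (by fun_prop) continuous_const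
    filter_upwards [hopen.mem_nhds ht] with u hu
    exact (heval u hu).sub (heval t ht)

lemma continuous_combCochain_coboundary :
    Continuous fun s : C(unitInterval, combSpace) => combCochain (s 1) - combCochain (s 0) := by
  refine continuous_iff_continuousAt.2 fun s => ?_
  refine PreconnectedSpace.induction₂' (fun t u : unitInterval => ContinuousAt
    (fun s' : C(unitInterval, combSpace) => combCochain (s' u) - combCochain (s' t)) s)
    (fun t => ?_) ⟨fun t u v htu huv => ?_⟩ 0 1
  · filter_upwards [eventually_continuousAt_sub s t] with u hu
    exact ⟨hu, hu.neg.congr (.of_forall fun _ => neg_sub _ _)⟩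
  · exact (huv.add htu).congr (.of_forall fun _ => sub_add_sub_cancel _ _ _)

lemma joinedIn_combSpace_of_prod {A B : Set ℝ} (hA : Convex ℝ A) (hB : Convex ℝ B)
    (h : A ×ˢ B ⊆ combSpace) {p q : ℝ × ℝ} (hp : p ∈ A ×ˢ B) (hq : q ∈ A ×ˢ B) :
    JoinedIn combSpace p q :=
  .of_segment_subset (((hA.prod hB).segment_subset hp hq).trans h)

lemma joinedIn_combSpace_zero (n : ℕ) (hn : 1 ≤ n) :
    JoinedIn combSpace (0, 0) ((1 : ℝ) / n, 0) := by
  have hn0 : (0 : ℝ) < 1 / n := by positivity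
  have hn1 : (1 : ℝ) / n ≤ 1 := by
    rw [div_le_one (by positivity)]
    exact_mod_cast hn
  have h₁ : JoinedIn combSpace (0, 0) (0, -1) :=
    joinedIn_combSpace_of_prod (convex_singleton 0) (convex_Icc (-1) 0)
      (fun p hp => by simp at hp; rw [mem_combSpace]; grind) (by simp) (by simp)
  have h₂ : JoinedIn combSpace (0, -1) (1, -1) :=
    joinedIn_combSpace_of_prod (convex_Icc 0 1) (convex_singleton (-1))
      (fun p hp => by simp at hp; rw [mem_combSpace]; grind) (by simp) (by simp)
  have h₃ : JoinedIn combSpace (1, -1) (1, 1) :=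
    joinedIn_combSpace_of_prod (convex_singleton 1) (convex_Icc (-1) 1)
      (fun p hp => by simp at hp; rw [mem_combSpace]; grind) (by simp) (by simp)
  have h₄ : JoinedIn combSpace (1, 1) ((1 : ℝ) / n, 1) :=
    joinedIn_combSpace_of_prod (convex_Ioc 0 1) (convex_singleton 1)
      (fun p hp => by simp at hp; rw [mem_combSpace]; grind) (by simp)
      (mk_mem_prod ⟨hn0, hn1⟩ rfl)
  have h₅ : JoinedIn combSpace ((1 : ℝ) / n, 1) ((1 : ℝ) / n, 0) :=
    joinedIn_combSpace_of_prod (convex_singleton ((1 : ℝ) / n)) (convex_Icc 0 1)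
      (fun p hp => mem_combSpace.2 (.inl (.inl (.inl ⟨⟨n, hn, hp.1⟩, hp.2⟩))))
      (by simp) (by simp)
  exact h₁.trans (h₂.trans (h₃.trans (h₄.trans h₅)))

lemma not_exists_continuous_coboundary_eq :
    ¬ ∃ g : combSpace → ℝ, Continuous g ∧
      ∀ s : C(unitInterval, combSpace),
        combCochain (s 1) - combCochain (s 0) = g (s 1) - g (s 0) := by
  rintro ⟨g, hg, h⟩
  have hJ (n : ℕ) := joinedIn_combSpace_zero (n + 2) (by omega)
  let o : combSpace := ⟨(0, 0), (hJ 0).source_mem⟩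
  let p (n : ℕ) : combSpace := ⟨((1 : ℝ) / (n + 2 : ℕ), 0), (hJ n).target_mem⟩
  have hgp (n : ℕ) : g (p n) = g o + 1 := by
    obtain ⟨γ⟩ : Joined o (p n) := (joinedIn_iff_joined _ _).1 (hJ n)
    have hγ := h γ.toContinuousMap
    have h1 : γ.toContinuousMap 1 = p n := γ.target
    have h0 : γ.toContinuousMap 0 = o := γ.source
    have ho : combCochain o = 0 := if_pos (.inl rfl)
    have hp : combCochain (p n) = 1 := by
      rw [combCochain_of_mem_Ioo]
      · simp [p]
      · simp only [p]
        positivity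
      · simp only [p]
        rw [div_lt_one (by positivity)]
        exact_mod_cast (by omega : 1 < n + 2)
      · simp [p]
    rw [h1, h0, ho, hp] at hγ
    linarith
  have hlim : Tendsto p atTop (𝓝 o) := by
    rw [tendsto_subtype_rng]
    exact ((tendsto_const_div_atTop_nhds_zero_nat (1 : ℝ)).comp
      (tendsto_add_atTop_nat 2)).prodMk_nhds tendsto_const_nhds
  have hglim := (hg.tendsto o).comp hlim
  have := tendsto_nhds_unique hglim (tendsto_const_nhds.congr fun n => (hgp n).symm)
  linarith

/-- The coboundary of `combCochain` is a continuous 1-cochain on the comb space, but it is not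
the coboundary of any continuous 0-cochain. Consequently `i¹ : H¹_c(X₂) → H¹(X₂)` is not
injective. -/
theorem comb_coboundary_continuous_not_continuous_coboundary :
    Continuous (fun s : C(unitInterval, combSpace) => combCochain (s 1) - combCochain (s 0)) ∧
    ¬ ∃ g : combSpace → ℝ, Continuous g ∧
      ∀ s : C(unitInterval, combSpace),
        combCochain (s 1) - combCochain (s 0) = g (s 1) - g (s 0) := by
  exact ⟨continuous_combCochain_coboundary, not_exists_continuous_coboundary_eq⟩
end

section
/- Let X be a topological space, x₀ ∈ X, and H : X × [0,1] → X a continuous map with H(x, 1) = x₀ for every x ∈ X. For n ∈ ℕ and s ∈ C(Δⁿ, X), define Tₙ(s) : Δⁿ⁺¹ → X as follows: for p ∈ Δⁿ⁺¹ ⊆ ℝⁿ⁺² with first barycentric coordinate p₀ < 1, set Tₙ(s)(p) = H(s(q), p₀), where q ∈ Δⁿ has coordinates qᵢ = p_{i+1}/(1 − p₀) for 0 ≤ i ≤ n; and for p₀ = 1 (i.e., p the 0-th vertex of Δⁿ⁺¹), set Tₙ(s)(p) = x₀. Then Tₙ(s) is a well-defined continuous map Δⁿ⁺¹ → X, and the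 resulting map Tₙ : C(Δⁿ, X) → C(Δⁿ⁺¹, X) is continuous when both mapping spaces carry the compact-open topology. -/
/-- Each barycentric coordinate of a point of the standard simplex lies in `[0,1]`. -/
lemma stdSimplex_coord_mem_Icc {m : ℕ} (p : stdSimplex ℝ (Fin m)) (i : Fin m) :
    (p : Fin m → ℝ) i ∈ Set.Icc (0 : ℝ) 1 := by
  refine ⟨p.2.1 i, ?_⟩
  calc (p : Fin m → ℝ) i ≤ ∑ j, (p : Fin m → ℝ) j :=
        Finset.single_le_sum (fun j _ => p.2.1 j) (Finset.mem_univ i)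
    _ = 1 := p.2.2

/-- The radial projection of `Δⁿ⁺¹` minus its `0`-th vertex onto the opposite face, extended by an
arbitrary value at the `0`-th vertex. -/
noncomputable def stdSimplexRadialProj {n : ℕ} (p : stdSimplex ℝ (Fin (n + 2))) :
    stdSimplex ℝ (Fin (n + 1)) :=
  if h : (p : Fin (n + 2) → ℝ) 0 < 1 then
    ⟨fun i => (p : Fin (n + 2) → ℝ) i.succ / (1 - (p : Fin (n + 2) → ℝ) 0),
      fun i => div_nonneg (p.2.1 _) (sub_nonneg.2 h.le), by
        have hp := p.2.2
        rw [Fin.sum_univ_succ] at hp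
        rw [← Finset.sum_div, div_eq_one_iff_eq (sub_pos.2 h).ne']
        exact eq_sub_of_add_eq' hp⟩
  else ⟨Pi.single 0 1, single_mem_stdSimplex ℝ 0⟩

lemma stdSimplexRadialProj_apply {n : ℕ} {p : stdSimplex ℝ (Fin (n + 2))}
    (h : (p : Fin (n + 2) → ℝ) 0 < 1) (i : Fin (n + 1)) :
    (stdSimplexRadialProj p : Fin (n + 1) → ℝ) i =
      (p : Fin (n + 2) → ℝ) i.succ / (1 - (p : Fin (n + 2) → ℝ) 0) := by
  rw [stdSimplexRadialProj, dif_pos h]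
  rfl

lemma continuous_stdSimplex_coord {m : ℕ} (i : Fin m) :
    Continuous fun p : stdSimplex ℝ (Fin m) => (p : Fin m → ℝ) i :=
  (continuous_apply i).comp continuous_subtype_val

lemma continuousAt_stdSimplexRadialProj {n : ℕ} {p : stdSimplex ℝ (Fin (n + 2))}
    (h : (p : Fin (n + 2) → ℝ) 0 < 1) : ContinuousAt stdSimplexRadialProj p := by
  rw [Topology.IsInducing.subtypeVal.continuousAt_iff, continuousAt_pi]
  intro i
  have hdiv : ContinuousAt (fun p : stdSimplex ℝ (Fin (n + 2)) =>
      (p : Fin (n + 2) → ℝ) i.succ / (1 - (p : Fin (n + 2) → ℝ) 0)) p :=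
    (continuous_stdSimplex_coord i.succ).continuousAt.div
      (continuous_const.sub (continuous_stdSimplex_coord 0)).continuousAt (sub_pos.2 h).ne'
  refine hdiv.congr ?_
  filter_upwards [(isOpen_lt (continuous_stdSimplex_coord 0) continuous_const).mem_nhds h]
    with r hr
  exact (stdSimplexRadialProj_apply hr i).symm

open Topology in
/-- A homotopy ending at a constant map, evaluated along continuous maps from a compact space, is
jointly continuous at time `1`, whatever the (possibly discontinuous) choice of base point. -/
lemma continuousAt_homotopy_eval_of_eq_one {X K P : Type*} [TopologicalSpace X]
    [TopologicalSpace K] [CompactSpace K] [TopologicalSpace P] {x₀ : X}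
    {H : X × unitInterval → X} (hH : Continuous H) (hH1 : ∀ x : X, H (x, 1) = x₀)
    {q : P → K} {t : P → unitInterval} (ht : Continuous t) (s : C(K, X)) {p : P} (hp : t p = 1) :
    ContinuousAt (fun a : C(K, X) × P => H (a.1 (q a.2), t a.2)) (s, p) := by
  intro U hU
  simp only [hp, hH1] at hU
  obtain ⟨W, hWU, hW, hxW⟩ := mem_nhds_iff.1 hU
  obtain ⟨u, v, hu, hv, hsu, h1v, huv⟩ := generalized_tube_lemma
    (isCompact_range s.continuous) (isCompact_singleton (x := (1 : unitInterval)))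
    (hW.preimage hH) (by
      rintro ⟨x, r⟩ ⟨-, hr⟩
      obtain rfl : r = 1 := hr
      simpa [hH1] using hxW)
  have hmaps : ∀ᶠ f : C(K, X) in 𝓝 s, Set.MapsTo f Set.univ u :=
    ContinuousMap.eventually_mapsTo isCompact_univ hu fun k _ => hsu (Set.mem_range_self k)
  have htime : ∀ᶠ r in 𝓝 p, t r ∈ v :=
    ht.continuousAt.eventually (hv.mem_nhds (hp ▸ h1v rfl))
  rw [Filter.mem_map, nhds_prod_eq]
  filter_upwards [hmaps.prod_mk htime] with a ha
  exact hWU (huv ⟨ha.1 (Set.mem_univ _), ha.2⟩)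

/-- The cone construction: given a contracting homotopy `H` of `X` onto `x₀`, there is a
well-defined operator `Tₙ : C(Δⁿ, X) → C(Δⁿ⁺¹, X)` sending `s` to the cone over `s` with
vertex `x₀`; moreover `Tₙ` is continuous for the compact-open topologies. -/
theorem exists_continuous_cone_operator
    {X : Type*} [TopologicalSpace X] (x₀ : X)
    (H : X × unitInterval → X) (hH : Continuous H)
    (hH1 : ∀ x : X, H (x, 1) = x₀) (n : ℕ) :
    ∃ T : C(stdSimplex ℝ (Fin (n + 1)), X) → C(stdSimplex ℝ (Fin (n + 2)), X),
      Continuous T ∧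
      (∀ (s : C(stdSimplex ℝ (Fin (n + 1)), X)) (p : stdSimplex ℝ (Fin (n + 2))),
        (p : Fin (n + 2) → ℝ) 0 = 1 → T s p = x₀) ∧
      (∀ (s : C(stdSimplex ℝ (Fin (n + 1)), X)) (p : stdSimplex ℝ (Fin (n + 2))),
        (p : Fin (n + 2) → ℝ) 0 < 1 →
        ∀ q : stdSimplex ℝ (Fin (n + 1)),
          (∀ i : Fin (n + 1),
            (q : Fin (n + 1) → ℝ) i = (p : Fin (n + 2) → ℝ) i.succ / (1 - (p : Fin (n + 2) → ℝ) 0)) →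
          T s p = H (s q, ⟨(p : Fin (n + 2) → ℝ) 0, stdSimplex_coord_mem_Icc p 0⟩)) := by
  let t : stdSimplex ℝ (Fin (n + 2)) → unitInterval :=
    fun p => ⟨(p : Fin (n + 2) → ℝ) 0, stdSimplex_coord_mem_Icc p 0⟩
  have ht : Continuous t := (continuous_stdSimplex_coord 0).subtype_mk _
  let F : C(stdSimplex ℝ (Fin (n + 1)), X) × stdSimplex ℝ (Fin (n + 2)) → X :=
    fun a => H (a.1 (stdSimplexRadialProj a.2), t a.2)
  have hF : Continuous F := by
    refine continuous_iff_continuousAt.2 fun ⟨s, p⟩ => ?_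
    rcases (stdSimplex_coord_mem_Icc p 0).2.lt_or_eq with hp | hp
    · have hproj : ContinuousAt
          (fun a : C(stdSimplex ℝ (Fin (n + 1)), X) × stdSimplex ℝ (Fin (n + 2)) =>
            stdSimplexRadialProj a.2) (s, p) :=
        ContinuousAt.comp (continuousAt_stdSimplexRadialProj hp) continuousAt_snd
      have heval : ContinuousAt
          (fun a : C(stdSimplex ℝ (Fin (n + 1)), X) × stdSimplex ℝ (Fin (n + 2)) =>
            a.1 (stdSimplexRadialProj a.2)) (s, p) :=
        ContinuousAt.comp (g := fun b : C(stdSimplex ℝ (Fin (n + 1)), X) ×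
          stdSimplex ℝ (Fin (n + 1)) => b.1 b.2)
          continuous_eval.continuousAt (continuousAt_fst.prodMk hproj)
      exact ContinuousAt.comp hH.continuousAt
        (heval.prodMk (ht.continuousAt.comp continuousAt_snd))
    · exact continuousAt_homotopy_eval_of_eq_one hH hH1 ht s (Subtype.ext hp)
  refine ⟨ContinuousMap.curry ⟨F, hF⟩, ContinuousMap.continuous _, fun s p hp => ?_,
    fun s p hp q hq => ?_⟩
  · have h1 : t p = 1 := Subtype.ext hp
    change H (_, t p) = x₀
    rw [h1, hH1]
  · have hqp : stdSimplexRadialProj p = q :=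
      Subtype.ext (funext fun i => (stdSimplexRadialProj_apply hp i).trans (hq i).symm)
    change H (s (stdSimplexRadialProj p), t p) = _
    rw [hqp]
end
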